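/- The Böttcher–Wenzel inequality: for any two complex d×d matrices A and B, the squared Frobenius norm of their commutator satisfies ‖[A,B]‖₂² ≤ 2‖A‖₂²‖B‖₂². -/

import Mathlib

open Matrix
open scoped ComplexOrder

/-- A weighted Popoviciu-type variance bound. -/
theorem weighted_variance_le_half_sum_sq {ι : Type*} [Fintype ι] (q a : ι → ℝ)
    (hq : ∀ i, 0 ≤ q i) :
    (∑ i, q i) * (∑ i, q i * a i ^ 2) - (∑ i, q i * a i) ^ 2 ≤
      1 / 2 * (∑ i, q i) ^ 2 * ∑ i, a i ^ 2 := by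
  classical
  cases isEmpty_or_nonempty ι
  · simp
  obtain ⟨j, -, hj⟩ := Finset.exists_min_image Finset.univ a Finset.univ_nonempty
  obtain ⟨k, -, hk⟩ := Finset.exists_max_image Finset.univ a Finset.univ_nonempty
  have hprod : 0 ≤ ∑ i, q i * ((a k - a i) * (a i - a j)) :=
    Finset.sum_nonneg fun i hi ↦ mul_nonneg (hq i)
      (mul_nonneg (sub_nonneg.2 (hk i hi)) (sub_nonneg.2 (hj i hi)))
  have hexpand : ∑ i, q i * ((a k - a i) * (a i - a j)) =
      (a k + a j) * (∑ i, q i * a i) - a k * a j * (∑ i, q i) - ∑ i, q i * a i ^ 2 := by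
    simp only [Finset.mul_sum, ← Finset.sum_sub_distrib]
    exact Finset.sum_congr rfl fun i _ ↦ by ring
  have hQ : 0 ≤ ∑ i, q i := Finset.sum_nonneg fun i _ ↦ hq i
  have hspread : (a k - a j) ^ 2 ≤ 2 * ∑ i, a i ^ 2 := by
    by_cases hjk : j = k
    · subst hjk
      simpa using Finset.sum_nonneg fun i _ ↦ sq_nonneg (a i)
    · have hpair := Finset.sum_le_univ_sum_of_nonneg (s := {j, k}) fun i ↦ sq_nonneg (a i)
      rw [Finset.sum_pair hjk] at hpair
      nlinarith [sq_nonneg (a k + a j)]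
  rw [hexpand] at hprod
  generalize ∑ i, q i = Q at *
  generalize ∑ i, q i * a i = m at *
  nlinarith [mul_nonneg hQ hprod, mul_le_mul_of_nonneg_left hspread (sq_nonneg Q),
    sq_nonneg (2 * m - (a k + a j) * Q)]

namespace Matrix

variable {n : Type*} [Fintype n]

/-- The variance of a Hermitian matrix with respect to a positive semidefinite weight. -/
theorem IsHermitian.variance_le {A P : Matrix n n ℂ} (hA : A.IsHermitian) (hP : P.PosSemidef) :
    P.trace.re * (A * A * P).trace.re - (A * P).trace.re ^ 2 ≤
      1 / 2 * P.trace.re ^ 2 * (A * A).trace.re := by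
  classical
  set U : Matrix n n ℂ := (hA.eigenvectorUnitary : Matrix n n ℂ) with hU
  set D : Matrix n n ℂ := diagonal fun i ↦ (hA.eigenvalues i : ℂ) with hD
  have hUU : Uᴴ * U = 1 := Unitary.coe_star_mul_self hA.eigenvectorUnitary
  have hUU' : U * Uᴴ = 1 := Unitary.coe_mul_star_self hA.eigenvectorUnitary
  have hAD : A = U * D * Uᴴ := by
    simpa [Unitary.conjStarAlgAut_apply, hU, hD, star_eq_conjTranspose, Function.comp_def]
      using hA.spectral_theorem
  have hAA : A * A = U * (D * D) * Uᴴ := by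
    calc A * A = U * D * (Uᴴ * U) * D * Uᴴ := by rw [hAD]; noncomm_ring
      _ = _ := by rw [hUU]; noncomm_ring
  have hQ : (Uᴴ * P * U).PosSemidef := hP.conjTranspose_mul_mul_same U
  have hconj (M : Matrix n n ℂ) : (U * M * Uᴴ * P).trace = (M * (Uᴴ * P * U)).trace := by
    rw [Matrix.mul_assoc, Matrix.mul_assoc, trace_mul_comm]
    simp only [Matrix.mul_assoc]
  have hPQ : P.trace = (Uᴴ * P * U).trace := by
    simpa [hUU'] using hconj 1
  have htrAA : (A * A).trace = (D * D).trace := by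
    rw [hAA, trace_mul_comm, ← Matrix.mul_assoc, hUU, Matrix.one_mul]
  have key := weighted_variance_le_half_sum_sq (fun i ↦ ((Uᴴ * P * U) i i).re) hA.eigenvalues
    fun i ↦ (Complex.nonneg_iff.1 (hQ.diag_nonneg (i := i))).1
  rw [htrAA, hAA, hconj, hPQ, hAD, hconj]
  generalize Uᴴ * P * U = Q at *
  convert key using 3 <;>
    simp [hD, trace, diagonal_mul, pow_two, mul_comm]

theorem re_trace_conjTranspose_mul_self_nonneg (M : Matrix n n ℂ) : 0 ≤ (Mᴴ * M).trace.re :=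
  (Complex.nonneg_iff.1 (posSemidef_conjTranspose_mul_self M).trace_nonneg).1

/-- The Cauchy–Schwarz inequality for the Frobenius inner product. -/
theorem normSq_trace_conjTranspose_mul_le (Y W : Matrix n n ℂ) :
    Complex.normSq (Yᴴ * W).trace ≤ (Yᴴ * Y).trace.re * (Wᴴ * W).trace.re := by
  have hentries (S T : Matrix n n ℂ) :
      (Sᴴ * T).trace = ∑ p : n × n, star (S p.1 p.2) * T p.1 p.2 := by
    simp only [trace, diag, mul_apply, conjTranspose_apply, Fintype.sum_prod_type]
    exact Finset.sum_comm
  have hself (S : Matrix n n ℂ) : (Sᴴ * S).trace.re = ∑ p : n × n, ‖S p.1 p.2‖ ^ 2 := by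
    simp [hentries, Complex.sq_norm, Complex.normSq_apply]
  rw [hself, hself, ← Complex.sq_norm, hentries]
  refine le_trans ?_ (Finset.sum_mul_sq_le_sq_mul_sq _ _ _)
  gcongr
  exact (norm_sum_le _ _).trans_eq (by simp)

end Matrix

/-- Böttcher–Wenzel inequality: for complex `d × d` matrices `A`, `B`,
`‖[A,B]‖₂² ≤ 2 ‖A‖₂² ‖B‖₂²` where `‖X‖₂² = Tr(X†X)` is the squared
Hilbert–Schmidt (Frobenius) norm. -/
theorem boettcher_wenzel {d : ℕ} (A B : Matrix (Fin d) (Fin d) ℂ) :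
    (((A * B - B * A)ᴴ * (A * B - B * A)).trace).re ≤
      2 * ((Aᴴ * A).trace).re * ((Bᴴ * B).trace).re := by
  set N := ((Bᴴ * B).trace).re with hN
  have hN0 : 0 ≤ N := re_trace_conjTranspose_mul_self_nonneg B
  rcases hN0.eq_or_lt with hN0 | hNpos
  · have hB : (Bᴴ * B).trace = 0 := Complex.ext hN0.symm
      (Complex.nonneg_iff.1 (posSemidef_conjTranspose_mul_self B).trace_nonneg).2.symm
    rw [trace_conjTranspose_mul_self_eq_zero_iff] at hB
    simp [hB, ← hN0]
  set P := B * Bᴴ + Bᴴ * B with hP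
  have hPpsd : P.PosSemidef :=
    (posSemidef_self_mul_conjTranspose B).add (posSemidef_conjTranspose_mul_self B)
  have htrP : P.trace.re = 2 * N := by
    rw [hP, trace_add, trace_mul_comm B, Complex.add_re, hN]; ring
  -- The Hermitian and skew-Hermitian parts of `A`.
  set H := A + Aᴴ with hH
  set K := Complex.I • (A - Aᴴ) with hK
  have hHherm : H.IsHermitian := isHermitian_add_transpose_self A
  have hKherm : K.IsHermitian := by
    ext i j
    simp [hK]
    ring
  have hsq : H * H + K * K = (2 : ℂ) • (Aᴴ * A + A * Aᴴ) := by
    simp only [hK, smul_mul_smul_comm, Complex.I_mul_I, hH, two_smul, neg_smul, one_smul]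
    noncomm_ring
  have hsum : (H * H * P).trace.re + (K * K * P).trace.re =
      2 * ((Aᴴ * A + A * Aᴴ) * P).trace.re := by
    rw [← Complex.add_re, ← trace_add, ← Matrix.add_mul, hsq, Matrix.smul_mul, trace_smul]
    simp
  have hnorm : (H * H).trace.re + (K * K).trace.re = 4 * (Aᴴ * A).trace.re := by
    rw [← Complex.add_re, ← trace_add, hsq, trace_smul, trace_add, trace_mul_comm A]
    simp
    ring
  have hpolar : ((A * B - B * A)ᴴ * (A * B - B * A)).trace.re +
      ((Aᴴ * B + B * Aᴴ)ᴴ * (Aᴴ * B + B * Aᴴ)).trace.re =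
      ((Aᴴ * A + A * Aᴴ) * P).trace.re := by
    have hcycle (R S T V : Matrix (Fin d) (Fin d) ℂ) :
        (R * (S * (T * V))).trace = (S * (T * (V * R))).trace := by
      rw [trace_mul_comm R]
      simp only [Matrix.mul_assoc]
    rw [← Complex.add_re, hP]
    congr 1
    simp only [conjTranspose_sub, conjTranspose_add, conjTranspose_mul, conjTranspose_conjTranspose,
      Matrix.add_mul, Matrix.mul_add, Matrix.sub_mul, Matrix.mul_sub, trace_add, trace_sub,
      Matrix.mul_assoc]
    rw [hcycle Bᴴ Aᴴ A B, hcycle A Bᴴ Aᴴ B, hcycle Aᴴ Bᴴ A B, hcycle Bᴴ A Aᴴ B,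
      hcycle A Bᴴ B Aᴴ, hcycle Bᴴ B Aᴴ A, hcycle B Aᴴ A Bᴴ, hcycle Aᴴ Bᴴ B A,
      hcycle Bᴴ B A Aᴴ, hcycle B A Aᴴ Bᴴ]
    ring
  have hCS := normSq_trace_conjTranspose_mul_le B (Aᴴ * B + B * Aᴴ)
  have hinner : (Bᴴ * (Aᴴ * B + B * Aᴴ)).trace = (Aᴴ * P).trace := by
    simp only [hP, Matrix.mul_add, trace_add]
    rw [trace_mul_comm Bᴴ, trace_mul_comm Aᴴ (Bᴴ * B)]
    simp only [Matrix.mul_assoc]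
  have hAP : (A * P).trace = star (Aᴴ * P).trace := by
    rw [← trace_conjTranspose, conjTranspose_mul, conjTranspose_conjTranspose, hPpsd.1.eq,
      trace_mul_comm]
  have hHK : (H * P).trace.re ^ 2 + (K * P).trace.re ^ 2 =
      4 * Complex.normSq (Aᴴ * P).trace := by
    simp only [hH, hK, Matrix.add_mul, Matrix.smul_mul, Matrix.sub_mul, trace_add, trace_sub,
      trace_smul, hAP, Complex.normSq_apply]
    simp
    ring
  have hvH := hHherm.variance_le hPpsd
  have hvK := hKherm.variance_le hPpsd
  rw [htrP] at hvH hvK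
  rw [hinner] at hCS
  refine le_of_mul_le_mul_left ?_ hNpos
  nlinarith
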